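/- For any positive integers K, n_maj, n_min and any τ ∈ [0,1], the minimax excess risk over the group-covariate shift class P_GS(τ) is at least (1/(32K²)) · Σ_{j=1}^K exp( −KL( Q(S | v_j = 1) ‖ Q(S | v_j = −1) ) ), where the hard group-shift family and the law Q are as defined in the context. -/

import Mathlib

open MeasureTheory Set
open scoped ENNReal Classical

noncomputable section

/-! ## Basic setup: distributions on `ℝ × Bool`, risk, excess risk.

A labelled example is a pair `(x, y) : ℝ × Bool`, where the label `true` codes `+1`
and `false` codes `-1`; features are supported on `[0,1]`. -/

/-- The risk (probability of misclassification) of a classifier `f : ℝ → Bool`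
under a distribution `P` on `ℝ × Bool`. -/
def risk (f : ℝ → Bool) (P : Measure (ℝ × Bool)) : ℝ :=
  (P {p : ℝ × Bool | f p.1 ≠ p.2}).toReal

/-- The Bayes risk of a distribution: the infimum of the risk over all classifiers. -/
def bayesRisk (P : Measure (ℝ × Bool)) : ℝ :=
  ⨅ f : ℝ → Bool, risk f P

/-- The balanced test distribution `P_test = (1/2) P_maj + (1/2) P_min`. -/
def testMeasure (Pmaj Pmin : Measure (ℝ × Bool)) : Measure (ℝ × Bool) :=
  (2 : ℝ≥0∞)⁻¹ • Pmaj + (2 : ℝ≥0∞)⁻¹ • Pmin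

/-- A training sample: `nmaj` labelled points from the majority distribution and
`nmin` labelled points from the minority distribution. -/
abbrev Sample (nmaj nmin : ℕ) : Type :=
  (Fin nmaj → ℝ × Bool) × (Fin nmin → ℝ × Bool)

/-- The law `P_maj^{n_maj} × P_min^{n_min}` of the training sample. -/
def sampleMeasure (nmaj nmin : ℕ) (Pmaj Pmin : Measure (ℝ × Bool)) :
    Measure (Sample nmaj nmin) :=
  (Measure.pi fun _ : Fin nmaj => Pmaj).prod (Measure.pi fun _ : Fin nmin => Pmin)

/-- An algorithm (a map from samples to classifiers) is measurable if the joint map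
`(S, x) ↦ A S x` is measurable. -/
def MeasurableAlg (nmaj nmin : ℕ) (A : Sample nmaj nmin → ℝ → Bool) : Prop :=
  Measurable fun p : Sample nmaj nmin × ℝ => A p.1 p.2

/-- The expected excess risk of the algorithm `A` on the pair `(P_maj, P_min)`:
`E_{S ~ P_maj^{n_maj} × P_min^{n_min}}[R(A^S; P_test)] - R(f^*; P_test)`. -/
def excessRisk (nmaj nmin : ℕ) (A : Sample nmaj nmin → ℝ → Bool)
    (Pmaj Pmin : Measure (ℝ × Bool)) : ℝ :=
  (∫ S, risk (A S) (testMeasure Pmaj Pmin) ∂sampleMeasure nmaj nmin Pmaj Pmin)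
    - bayesRisk (testMeasure Pmaj Pmin)

/-- The distribution on `ℝ × Bool` supported on label `y` whose feature has density `p`
(w.r.t. Lebesgue measure) on `[0,1]`. -/
def labelMeasure (p : ℝ → ℝ) (y : Bool) : Measure (ℝ × Bool) :=
  Measure.map (fun x => (x, y))
    ((volume.restrict (Icc (0:ℝ) 1)).withDensity fun x => ENNReal.ofReal (p x))

/-- The label-shift class `𝒫_LS`: `P_maj(x,y) = P₁(x)·1{y = 1}`,
`P_min(x,y) = P₋₁(x)·1{y = -1}` with `P₁, P₋₁` 1-Lipschitz densities on `[0,1]`. -/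
def memLS (Pmaj Pmin : Measure (ℝ × Bool)) : Prop :=
  ∃ p1 pm1 : ℝ → ℝ,
    (∀ x, 0 ≤ p1 x) ∧ (∀ x, 0 ≤ pm1 x) ∧
    LipschitzOnWith 1 p1 (Icc 0 1) ∧ LipschitzOnWith 1 pm1 (Icc 0 1) ∧
    (∫ x in Icc (0:ℝ) 1, p1 x) = 1 ∧ (∫ x in Icc (0:ℝ) 1, pm1 x) = 1 ∧
    Pmaj = labelMeasure p1 true ∧ Pmin = labelMeasure pm1 false

/-- Total variation distance between two densities on `[0,1]`:
`TV(p, q) = (1/2)∫₀¹ |p - q|`. -/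
def tvDist (p q : ℝ → ℝ) : ℝ :=
  (1/2) * ∫ x in Icc (0:ℝ) 1, |p x - q x|

/-- The distribution on `ℝ × Bool` whose feature has density `p` on `[0,1]` and whose
label is `true` with probability `η x` conditionally on the feature `x`. -/
def covMeasure (p η : ℝ → ℝ) : Measure (ℝ × Bool) :=
  labelMeasure (fun x => p x * η x) true + labelMeasure (fun x => p x * (1 - η x)) false

/-- The group-covariate shift class `𝒫_GS(τ)`: `P_maj(x,y) = P_a(x)·P(y|x)`,
`P_min(x,y) = P_b(x)·P(y|x)` with group densities `P_a, P_b` on `[0,1]`,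
a shared 1-Lipschitz conditional label distribution, and overlap
`1 - TV(P_a, P_b) ≥ τ`. -/
def memGS (τ : ℝ) (Pmaj Pmin : Measure (ℝ × Bool)) : Prop :=
  ∃ pa pb η : ℝ → ℝ,
    (∀ x, 0 ≤ pa x) ∧ (∀ x, 0 ≤ pb x) ∧
    (∫ x in Icc (0:ℝ) 1, pa x) = 1 ∧ (∫ x in Icc (0:ℝ) 1, pb x) = 1 ∧
    (∀ x, 0 ≤ η x ∧ η x ≤ 1) ∧
    LipschitzOnWith 1 η (Icc 0 1) ∧ LipschitzOnWith 1 (fun x => 1 - η x) (Icc 0 1) ∧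
    τ ≤ 1 - tvDist pa pb ∧
    Pmaj = covMeasure pa η ∧ Pmin = covMeasure pb η

/-! ## The hat function -/

/-- The hat function `φ_K`. -/
def hatFun (K : ℕ) (x : ℝ) : ℝ :=
  if x ∈ Icc (-(1/(2*(K:ℝ)))) 0 then |x + 1/(4*(K:ℝ))| - 1/(4*(K:ℝ))
  else if x ∈ Icc (0:ℝ) (1/(2*(K:ℝ))) then 1/(4*(K:ℝ)) - |x - 1/(4*(K:ℝ))|
  else 0

/-! ## The hard family for the label-shift lower bound.

Bins are 0-indexed: `I_j = [j/K, (j+1)/K)` for `j = 0, …, K-1`, corresponding to the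
paper's `I_{j+1} = [((j+1)-1)/K, (j+1)/K]`; the bin center is `(j + 1/2)/K`. -/

/-- The value in `{-1, 0, 1}` coded by an element of `Fin 3`. -/
def trit (i : Fin 3) : ℝ := (i : ℝ) - 1

/-- The perturbed density of the hard label-shift family: on the bin
`I_j = [j/K, (j+1)/K)` it equals `1 + v_j · φ_K(x - (j + 1/2)/K)`. -/
def hardDensityLS (K : ℕ) (v : Fin K → Fin 3) (x : ℝ) : ℝ :=
  1 + ∑ j : Fin K,
    (if x ∈ Ico ((j:ℝ)/(K:ℝ)) (((j:ℝ)+1)/(K:ℝ))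
      then trit (v j) * hatFun K (x - ((j:ℝ) + 1/2)/(K:ℝ)) else 0)

/-- The index set `𝒱 = {-1,0,1}^K × {-1,0,1}^K` of the hard label-shift family. -/
abbrev TritPair (K : ℕ) : Type := (Fin K → Fin 3) × (Fin K → Fin 3)

/-- The law `Q(S | v) = P_{v,maj}^{n_maj} × P_{v,min}^{n_min}` of the sample for the hard
label-shift instance indexed by `v`. -/
def hardLSMeasure (K nmaj nmin : ℕ) (v : TritPair K) : Measure (Sample nmaj nmin) :=
  sampleMeasure nmaj nmin (labelMeasure (hardDensityLS K v.1) true)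
    (labelMeasure (hardDensityLS K v.2) false)

/-- The marginal law `Q_S` of the sample when the index `V` is uniform on `𝒱`. -/
def hardLSMarginal (K nmaj nmin : ℕ) : Measure (Sample nmaj nmin) :=
  ∑ v : TritPair K, (Fintype.card (TritPair K) : ℝ≥0∞)⁻¹ • hardLSMeasure K nmaj nmin v

/-- The posterior weight `Q(v | S)`: the Radon–Nikodym derivative of
`(1/|𝒱|) · Q(S | v)` with respect to `Q_S`, evaluated at `S`. -/
def postLS (K nmaj nmin : ℕ) (v : TritPair K) (S : Sample nmaj nmin) : ℝ :=
  (((Fintype.card (TritPair K) : ℝ≥0∞)⁻¹ • hardLSMeasure K nmaj nmin v).rnDeriv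
      (hardLSMarginal K nmaj nmin) S).toReal

/-- The posterior mixture density `Σ_{v ∈ 𝒱} Q(v | S) · P_{v, ±1}`;
`cls = true` selects the class `+1` densities `P_{v,1}`. -/
def postMixLS (K nmaj nmin : ℕ) (S : Sample nmaj nmin) (cls : Bool) (x : ℝ) : ℝ :=
  ∑ v : TritPair K,
    postLS K nmaj nmin v S * hardDensityLS K (if cls then v.1 else v.2) x

/-! ## The hard family for the group-covariate shift lower bound -/

/-- The sign `+1` / `-1` coded by a Bool. -/
def sgnB (b : Bool) : ℝ := if b then 1 else -1

/-- `P_v(y = 1 | x)` for the hard group-shift family: on the bin `I_j = [j/K, (j+1)/K)` it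
equals `(1/2)(1 + v_j · φ_K(x - (j+1/2)/K))`. -/
def hardEta (K : ℕ) (v : Fin K → Bool) (x : ℝ) : ℝ :=
  (1/2) * (1 + ∑ j : Fin K,
    (if x ∈ Ico ((j:ℝ)/(K:ℝ)) (((j:ℝ)+1)/(K:ℝ))
      then sgnB (v j) * hatFun K (x - ((j:ℝ) + 1/2)/(K:ℝ)) else 0))

/-- The majority-group feature density: `2 - τ` on `[0, 1/2)` and `τ` on `[1/2, 1]`. -/
def hardPa (τ : ℝ) (x : ℝ) : ℝ := if x < 1/2 then 2 - τ else τ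

/-- The minority-group feature density `P_b = 2 - P_a`. -/
def hardPb (τ : ℝ) (x : ℝ) : ℝ := 2 - hardPa τ x

/-- The law `Q(S | v)` of the sample for the hard group-shift instance indexed by `v`. -/
def hardGSMeasure (K nmaj nmin : ℕ) (τ : ℝ) (v : Fin K → Bool) :
    Measure (Sample nmaj nmin) :=
  sampleMeasure nmaj nmin (covMeasure (hardPa τ) (hardEta K v))
    (covMeasure (hardPb τ) (hardEta K v))

/-- The conditional law `Q(S | v_j = b)` of the sample given the `j`-th coordinate of the
uniformly random index: the uniform mixture over all `v` with `v_j = b`. -/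
def condGS (K nmaj nmin : ℕ) (τ : ℝ) (j : Fin K) (b : Bool) :
    Measure (Sample nmaj nmin) :=
  ((Finset.univ.filter fun v : Fin K → Bool => v j = b).card : ℝ≥0∞)⁻¹ •
    ∑ v ∈ Finset.univ.filter (fun v : Fin K → Bool => v j = b),
      hardGSMeasure K nmaj nmin τ v

/-- The Kullback–Leibler divergence `KL(μ ‖ ν) = ∫ log (dμ/dν) dμ`. -/
def klDiv' {α : Type*} [MeasurableSpace α] (μ ν : Measure α) : ℝ :=
  ∫ x, Real.log ((μ.rnDeriv ν x).toReal) ∂μ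

/-! ## The undersampled binning estimator -/

/-- The prediction of the undersampled binning estimator on the bin `I_j = [j/K, (j+1)/K)`
(0-indexed), where `s ⊆ Fin nmaj` is the set of retained majority samples: predict `+1`
iff the samples of the undersampled dataset in the bin with label `+1` strictly
outnumber those with label `-1`. -/
def usbBinPred (nmaj nmin K : ℕ) (s : Finset (Fin nmaj)) (S : Sample nmaj nmin)
    (j : ℕ) : Bool :=
  decide
    ((s.filter fun i => (S.1 i).2 = false ∧
        (S.1 i).1 ∈ Ico ((j:ℝ)/(K:ℝ)) (((j:ℝ)+1)/(K:ℝ))).card +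
      (Finset.univ.filter fun i : Fin nmin => (S.2 i).2 = false ∧
        (S.2 i).1 ∈ Ico ((j:ℝ)/(K:ℝ)) (((j:ℝ)+1)/(K:ℝ))).card
      <
      (s.filter fun i => (S.1 i).2 = true ∧
        (S.1 i).1 ∈ Ico ((j:ℝ)/(K:ℝ)) (((j:ℝ)+1)/(K:ℝ))).card +
      (Finset.univ.filter fun i : Fin nmin => (S.2 i).2 = true ∧
        (S.2 i).1 ∈ Ico ((j:ℝ)/(K:ℝ)) (((j:ℝ)+1)/(K:ℝ))).card)

/-- The undersampled binning classifier `A_USB^{S,K}` with `K` bins, given the retained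
majority samples `s`: on each bin it predicts the majority label among the undersampled
data in that bin. -/
def usbClassifier (nmaj nmin K : ℕ) (s : Finset (Fin nmaj)) (S : Sample nmaj nmin) :
    ℝ → Bool :=
  fun x => usbBinPred nmaj nmin K s S (min ⌊x * (K:ℝ)⌋₊ (K - 1))

/-- The expected excess risk of the undersampled binning estimator with `K` bins, where the
`nmin` retained majority samples are drawn uniformly at random without replacement
(uniformly among all subsets of size `nmin`). -/
def usbExcessRisk (nmaj nmin K : ℕ) (Pmaj Pmin : Measure (ℝ × Bool)) : ℝ :=
  (∑ s ∈ Finset.powersetCard nmin (Finset.univ : Finset (Fin nmaj)),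
      ∫ S, risk (usbClassifier nmaj nmin K s S) (testMeasure Pmaj Pmin)
        ∂sampleMeasure nmaj nmin Pmaj Pmin)
    / ((Finset.powersetCard nmin (Finset.univ : Finset (Fin nmaj))).card : ℝ)
  - bayesRisk (testMeasure Pmaj Pmin)

/-- `q_{j,y} = P(y | x ∈ I_j)` for the 0-indexed bin `I_j = [j/K, (j+1)/K)`. -/
def qBin (P : Measure (ℝ × Bool)) (K j : ℕ) (y : Bool) : ℝ :=
  (P ((Ico ((j:ℝ)/(K:ℝ)) (((j:ℝ)+1)/(K:ℝ))) ×ˢ ({y} : Set Bool))).toReal /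
    (P ((Ico ((j:ℝ)/(K:ℝ)) (((j:ℝ)+1)/(K:ℝ))) ×ˢ (univ : Set Bool))).toReal

/-- The excess risk of the binning estimator in the bin `I_j`:
`R_j(A_USB^S) = q_{j, -A_j^S} - min{q_{j,1}, q_{j,-1}}`. -/
def binExcess (nmaj nmin K : ℕ) (s : Finset (Fin nmaj)) (S : Sample nmaj nmin)
    (P : Measure (ℝ × Bool)) (j : ℕ) : ℝ :=
  qBin P K j (!(usbBinPred nmaj nmin K s S j)) - min (qBin P K j true) (qBin P K j false)

/-- The binomial probability mass function `P[Bin(m, p) = k]`. -/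
def binomPMF (m : ℕ) (p : ℝ) (k : ℕ) : ℝ :=
  (m.choose k : ℝ) * p ^ k * (1 - p) ^ (m - k)

/-- A tangent-line form of the Bretagnolle–Huber inequality: with `r` the likelihood ratio and
`m` arbitrary, the pointwise two-point testing error dominates an affine function of
`r` and `r * log r`. -/
lemma exp_neg_mul_le_test_error {t r : ℝ} (m : ℝ) (ht0 : 0 ≤ t) (ht1 : t ≤ 1) (hr : 0 ≤ r) :
    Real.exp (-m) * ((1 + m) * r - r * Real.log r - Real.exp (-1)) ≤ t * r + (1 - t) := by
  rcases hr.eq_or_lt with rfl | hr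
  · have : 0 ≤ Real.exp (-m) * Real.exp (-1) := by positivity
    simp only [mul_zero, zero_mul, zero_sub, sub_zero]
    nlinarith
  have hmin : min r 1 ≤ t * r + (1 - t) := by
    rcases le_total r 1 with h | h
    · rw [min_eq_left h]; nlinarith
    · rw [min_eq_right h]; nlinarith
  refine le_trans ?_ hmin
  rcases le_total r 1 with h | h
  · rw [min_eq_left h]
    have h1 : -(r * Real.log r) ≤ Real.exp (-1) := by
      have h2 := Real.add_one_le_exp (-1 - Real.log r)
      rw [sub_eq_add_neg, Real.exp_add, Real.exp_neg (Real.log r), Real.exp_log hr] at h2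
      have h3 := mul_le_mul_of_nonneg_left h2 hr.le
      have h4 : r * (Real.exp (-1) * r⁻¹) = Real.exp (-1) := by field_simp
      linarith
    have h5 : Real.exp (-m) * (1 + m) ≤ 1 := by
      have := Real.add_one_le_exp m
      calc Real.exp (-m) * (1 + m) ≤ Real.exp (-m) * Real.exp m := by gcongr; linarith
        _ = 1 := by rw [← Real.exp_add]; simp
    calc Real.exp (-m) * ((1 + m) * r - r * Real.log r - Real.exp (-1))
        ≤ Real.exp (-m) * ((1 + m) * r) := by gcongr; linarith
      _ = Real.exp (-m) * (1 + m) * r := by ring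
      _ ≤ 1 * r := by gcongr
      _ = r := one_mul r
  · rw [min_eq_right h]
    have h5 : Real.exp (-m) * (1 + m - Real.log r) ≤ r⁻¹ := by
      have := Real.add_one_le_exp (m - Real.log r)
      calc Real.exp (-m) * (1 + m - Real.log r) ≤ Real.exp (-m) * Real.exp (m - Real.log r) := by
            gcongr; linarith
        _ = r⁻¹ := by
            rw [← Real.exp_add, neg_add_eq_sub, sub_sub_cancel_left, Real.exp_neg,
              Real.exp_log hr]
    calc Real.exp (-m) * ((1 + m) * r - r * Real.log r - Real.exp (-1))
        ≤ Real.exp (-m) * ((1 + m) * r - r * Real.log r) := by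
          exact mul_le_mul_of_nonneg_left (by linarith [Real.exp_pos (-1)]) (Real.exp_pos _).le
      _ = Real.exp (-m) * (1 + m - Real.log r) * r := by ring
      _ ≤ r⁻¹ * r := by gcongr
      _ = 1 := inv_mul_cancel₀ hr.ne'

lemma rnDeriv_toReal_le_of_le_smul {α : Type*} [MeasurableSpace α] {μ ν : Measure α}
    [IsFiniteMeasure μ] [IsFiniteMeasure ν] {C : NNReal} (hC : C ≠ 0) (h : μ ≤ C • ν) :
    ∀ᵐ x ∂ν, (μ.rnDeriv ν x).toReal ≤ C := by
  have h1 : C⁻¹ • μ ≤ ν := by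
    refine Measure.le_iff.2 fun s _ => ?_
    have h2 := h s
    simp only [Measure.smul_apply, ENNReal.smul_def, smul_eq_mul] at h2 ⊢
    rw [ENNReal.coe_inv hC, mul_comm, ← div_eq_mul_inv]
    exact ENNReal.div_le_of_le_mul' h2
  filter_upwards [Measure.rnDeriv_le_one_of_le h1, Measure.rnDeriv_smul_left μ ν C⁻¹] with x h3 h4
  rw [h4] at h3
  simp only [Pi.smul_apply, ENNReal.smul_def, smul_eq_mul, Pi.one_apply, ENNReal.coe_inv hC] at h3
  have h5 : μ.rnDeriv ν x ≤ C := by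
    rw [mul_comm, ← div_eq_mul_inv] at h3
    simpa using (ENNReal.div_le_iff (by simpa using hC) ENNReal.coe_ne_top).1 h3
  exact ENNReal.toReal_le_of_le_ofReal C.2 (by simpa using h5)

/-- A Bretagnolle–Huber type bound for randomized tests between two probability measures with
bounded likelihood ratio. -/
lemma half_exp_neg_klDiv'_le {α : Type*} [MeasurableSpace α] {μ ν : Measure α}
    [IsProbabilityMeasure μ] [IsProbabilityMeasure ν] {C : NNReal} (hC : C ≠ 0)
    (h : μ ≤ C • ν) {T : α → ℝ} (hT : Measurable T) (hT0 : ∀ x, 0 ≤ T x) (hT1 : ∀ x, T x ≤ 1) :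
    (1/2) * Real.exp (-(klDiv' μ ν)) ≤ (∫ x, T x ∂μ) + ∫ x, (1 - T x) ∂ν := by
  set r : α → ℝ := fun x => (μ.rnDeriv ν x).toReal
  have hac : μ ≪ ν := (Measure.absolutelyContinuous_of_le h).trans Measure.smul_absolutelyContinuous
  have hrm : Measurable r := (Measure.measurable_rnDeriv μ ν).ennreal_toReal
  have hr0 : ∀ x, 0 ≤ r x := fun x => ENNReal.toReal_nonneg
  have hrC := rnDeriv_toReal_le_of_le_smul hC h
  have hri : Integrable r ν := Measure.integrable_toReal_rnDeriv
  have hr1 : ∫ x, r x ∂ν = 1 := by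
    rw [Measure.integral_toReal_rnDeriv hac]; simp
  have hlog : Integrable (fun x => r x * Real.log (r x)) ν := by
    refine Integrable.of_bound (hrm.mul hrm.log).aestronglyMeasurable (1 + (C:ℝ)^2) ?_
    filter_upwards [hrC] with x hx
    have hx0 := hr0 x
    rw [Real.norm_eq_abs, abs_le]
    rcases hx0.eq_or_lt with h0 | h0
    · rw [← h0, zero_mul]; constructor <;> nlinarith
    have h1 := Real.log_le_sub_one_of_pos h0
    have h2 := Real.one_sub_inv_le_log_of_pos h0
    have h3 := mul_le_mul_of_nonneg_left h2 hx0
    have h4 : r x * (1 - (r x)⁻¹) = r x - 1 := by field_simp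
    have h6 : r x ≤ C := hx
    constructor <;> nlinarith
  have hTi : ∀ (ρ : Measure α) [IsProbabilityMeasure ρ], Integrable T ρ := fun ρ _ =>
    Integrable.of_bound hT.aestronglyMeasurable 1
      (ae_of_all _ fun x => by rw [Real.norm_eq_abs, abs_of_nonneg (hT0 x)]; exact hT1 x)
  have hTr : Integrable (fun x => r x * T x) ν := (integrable_rnDeriv_smul_iff hac).2 (hTi μ)
  have hμT : ∫ x, T x ∂μ = ∫ x, r x * T x ∂ν := (integral_rnDeriv_smul hac).symm
  have hkl : klDiv' μ ν = ∫ x, r x * Real.log (r x) ∂ν := (integral_rnDeriv_smul hac).symm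
  set m : ℝ := klDiv' μ ν + Real.exp (-1) with hm
  have hT' : Integrable (fun x => 1 - T x) ν := (integrable_const 1).sub (hTi ν)
  rw [hμT, ← integral_add hTr hT']
  have key : ∫ x, Real.exp (-m) * ((1 + m) * r x - r x * Real.log (r x) - Real.exp (-1)) ∂ν
      ≤ ∫ x, (r x * T x + (1 - T x)) ∂ν := by
    refine integral_mono ?_ (hTr.add hT') fun x => ?_
    · exact (((hri.const_mul _).sub hlog).sub (integrable_const _)).const_mul _
    · have := exp_neg_mul_le_test_error m (hT0 x) (hT1 x) (hr0 x)
      rwa [mul_comm (T x)] at this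
  refine le_trans ?_ key
  have h3 : ∫ x, ((1 + m) * r x - r x * Real.log (r x) - Real.exp (-1)) ∂ν
      = (1 + m) * 1 - klDiv' μ ν - Real.exp (-1) := by
    have hi : Integrable (fun x => (1 + m) * r x - r x * Real.log (r x)) ν :=
      (hri.const_mul _).sub hlog
    rw [integral_sub hi (integrable_const _), integral_sub (hri.const_mul _) hlog,
      integral_const_mul, hr1, ← hkl]
    simp
  rw [integral_const_mul, h3]
  have h1 : (1 + m) * 1 - klDiv' μ ν - Real.exp (-1) = 1 := by rw [hm]; ring
  rw [h1, mul_one, hm, neg_add, Real.exp_add, mul_comm]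
  gcongr
  have h2 : Real.exp (-1) ≤ 1/2 := by
    rw [Real.exp_neg, one_div]
    gcongr
    linarith [Real.add_one_le_exp 1]
  linarith [Real.add_one_le_exp (-Real.exp (-1))]

lemma hatFun_eq_max_min {K : ℕ} (hK : 0 < K) (x : ℝ) :
    hatFun K x = max (min x (max (1/(2*(K:ℝ)) - x) 0)) (min (-(1/(2*(K:ℝ))) - x) 0) := by
  have ha : 0 < 1/(4*(K:ℝ)) := by positivity
  have h2 : 1/(2*(K:ℝ)) = 2 * (1/(4*(K:ℝ))) := by field_simp; norm_num
  unfold hatFun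
  simp only [h2, mem_Icc]
  generalize 1/(4*(K:ℝ)) = a at *
  rcases abs_cases (x + a) with h | h <;> rcases abs_cases (x - a) with h' | h' <;>
    simp only [max_def, min_def] <;> split_ifs <;> grind

lemma lipschitzWith_hatFun {K : ℕ} (hK : 0 < K) : LipschitzWith 1 (hatFun K) := by
  have h1 : LipschitzWith 1 fun x : ℝ => 1/(2*(K:ℝ)) - x := by
    simpa using (LipschitzWith.const (1/(2*(K:ℝ)))).sub LipschitzWith.id
  have h2 : LipschitzWith 1 fun x : ℝ => -(1/(2*(K:ℝ))) - x := by
    simpa using (LipschitzWith.const (-(1/(2*(K:ℝ))))).sub LipschitzWith.id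
  have h3 : hatFun K = fun x =>
      max (min x (max (1/(2*(K:ℝ)) - x) 0)) (min (-(1/(2*(K:ℝ))) - x) 0) :=
    funext (hatFun_eq_max_min hK)
  rw [h3]
  simpa using (LipschitzWith.id.min (h1.max_const 0)).max (h2.min_const 0)

lemma abs_hatFun_le (K : ℕ) (x : ℝ) : |hatFun K x| ≤ 1/(4*(K:ℝ)) := by
  have ha : 0 ≤ 1/(4*(K:ℝ)) := by positivity
  have h2 : 1/(2*(K:ℝ)) = 2 * (1/(4*(K:ℝ))) := by field_simp; norm_num
  unfold hatFun
  simp only [h2, mem_Icc]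
  generalize 1/(4*(K:ℝ)) = a at *
  rw [abs_le]
  rcases abs_cases (x + a) with h | h <;> rcases abs_cases (x - a) with h' | h' <;>
    split_ifs <;> constructor <;> linarith

lemma hatFun_eq_zero_of_abs_ge {K : ℕ} (hK : 0 < K) {x : ℝ} (hx : 1/(2*(K:ℝ)) ≤ |x|) :
    hatFun K x = 0 := by
  have ha : 0 < 1/(2*(K:ℝ)) := by positivity
  rw [hatFun_eq_max_min hK]
  simp only [max_def, min_def]
  rcases abs_cases x with h | h <;> split_ifs <;> grind

/-- The perturbation of the hard family supported on the bin `[j/K, (j+1)/K)`. -/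
def binHat (K : ℕ) (j : Fin K) (x : ℝ) : ℝ :=
  if x ∈ Ico ((j:ℝ)/(K:ℝ)) (((j:ℝ)+1)/(K:ℝ)) then hatFun K (x - ((j:ℝ) + 1/2)/(K:ℝ)) else 0

lemma binHat_eq {K : ℕ} (j : Fin K) (x : ℝ) :
    binHat K j x = hatFun K (x - ((j:ℝ) + 1/2)/(K:ℝ)) := by
  have hK : 0 < K := j.pos
  have hK' : (0:ℝ) < K := by exact_mod_cast hK
  have h1 : (j:ℝ)/(K:ℝ) = ((j:ℝ) + 1/2)/(K:ℝ) - 1/(2*(K:ℝ)) := by field_simp; ring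
  have h2 : ((j:ℝ)+1)/(K:ℝ) = ((j:ℝ) + 1/2)/(K:ℝ) + 1/(2*(K:ℝ)) := by field_simp; ring
  unfold binHat
  split_ifs with h
  · rfl
  · refine (hatFun_eq_zero_of_abs_ge hK ?_).symm
    rw [mem_Ico, h1, h2, not_and_or, not_le, not_lt] at h
    rcases h with h | h
    · exact le_abs.2 (Or.inr (by linarith))
    · exact le_abs.2 (Or.inl (by linarith))

lemma abs_binHat_sub_le {K : ℕ} (j : Fin K) (x y : ℝ) :
    |binHat K j x - binHat K j y| ≤ |x - y| := by
  rw [binHat_eq, binHat_eq]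
  simpa [Real.dist_eq] using (lipschitzWith_hatFun j.pos).dist_le_mul
    (x - ((j:ℝ) + 1/2)/(K:ℝ)) (y - ((j:ℝ) + 1/2)/(K:ℝ))

lemma measurable_binHat {K : ℕ} (j : Fin K) : Measurable (binHat K j) := by
  have h : binHat K j = fun x => hatFun K (x - ((j:ℝ) + 1/2)/(K:ℝ)) := funext (binHat_eq j)
  rw [h]
  exact (lipschitzWith_hatFun j.pos).continuous.measurable.comp (measurable_id.sub_const _)

lemma abs_binHat_le {K : ℕ} (j : Fin K) (x : ℝ) : |binHat K j x| ≤ 1/4 := by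
  rw [binHat_eq]
  refine (abs_hatFun_le K _).trans ?_
  have : (1:ℝ) ≤ K := by exact_mod_cast j.pos
  gcongr
  linarith

lemma binHat_eq_zero_of_ne {K : ℕ} {i j : Fin K} {x : ℝ} (hi : binHat K i x ≠ 0) (hij : j ≠ i) :
    binHat K j x = 0 := by
  have hK' : (0:ℝ) < K := by exact_mod_cast j.pos
  by_contra hj
  have hi' : x ∈ Ico ((i:ℝ)/(K:ℝ)) (((i:ℝ)+1)/(K:ℝ)) := by
    by_contra h; exact hi (if_neg h)
  have hj' : x ∈ Ico ((j:ℝ)/(K:ℝ)) (((j:ℝ)+1)/(K:ℝ)) := by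
    by_contra h; exact hj (if_neg h)
  rw [mem_Ico, div_le_iff₀ hK', lt_div_iff₀ hK'] at hi' hj'
  have h1 : (i:ℝ) < j + 1 := by linarith [hi'.1, hj'.2]
  have h2 : (j:ℝ) < i + 1 := by linarith [hj'.1, hi'.2]
  have h3 : (i:ℕ) < j + 1 := by exact_mod_cast h1
  have h4 : (j:ℕ) < i + 1 := by exact_mod_cast h2
  exact hij (Fin.ext (by omega))

/-- At each point at most one bin contributes to the perturbation. -/
lemma exists_binHat_support {K : ℕ} (hK : 0 < K) (x : ℝ) :
    ∃ i : Fin K, ∀ j, j ≠ i → binHat K j x = 0 := by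
  by_cases h : ∃ i, binHat K i x ≠ 0
  · obtain ⟨i, hi⟩ := h
    exact ⟨i, fun j hj => binHat_eq_zero_of_ne hi hj⟩
  · push Not at h
    exact ⟨⟨0, hK⟩, fun j _ => h j⟩

/-- The perturbation `2 η - 1` of the hard family. -/
def hardBump (K : ℕ) (v : Fin K → Bool) (x : ℝ) : ℝ := ∑ j, sgnB (v j) * binHat K j x

lemma hardEta_eq (K : ℕ) (v : Fin K → Bool) (x : ℝ) :
    hardEta K v x = (1/2) * (1 + hardBump K v x) := by
  simp only [hardEta, hardBump, binHat, mul_ite, mul_zero]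

lemma abs_sgnB (b : Bool) : |sgnB b| = 1 := by cases b <;> simp [sgnB]

lemma hardBump_eq {K : ℕ} {v : Fin K → Bool} {x : ℝ} {i : Fin K}
    (hi : ∀ j, j ≠ i → binHat K j x = 0) : hardBump K v x = sgnB (v i) * binHat K i x :=
  Finset.sum_eq_single_of_mem i (Finset.mem_univ i) fun j _ hj => by rw [hi j hj, mul_zero]

lemma abs_hardBump {K : ℕ} (hK : 0 < K) (v : Fin K → Bool) (x : ℝ) :
    |hardBump K v x| = ∑ j, |binHat K j x| := by
  obtain ⟨i, hi⟩ := exists_binHat_support hK x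
  rw [hardBump_eq hi, abs_mul, abs_sgnB, one_mul]
  exact (Finset.sum_eq_single_of_mem (f := fun j => |binHat K j x|) i (Finset.mem_univ i)
    fun j _ hj => by simp only [hi j hj, abs_zero]).symm

lemma abs_hardBump_le {K : ℕ} (hK : 0 < K) (v : Fin K → Bool) (x : ℝ) :
    |hardBump K v x| ≤ 1/4 := by
  obtain ⟨i, hi⟩ := exists_binHat_support hK x
  rw [hardBump_eq hi, abs_mul, abs_sgnB, one_mul]
  exact abs_binHat_le i x

lemma measurable_hardBump (K : ℕ) (v : Fin K → Bool) : Measurable (hardBump K v) :=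
  Finset.measurable_sum _ fun j _ => (measurable_binHat j).const_mul _

lemma abs_hardBump_sub_le {K : ℕ} (hK : 0 < K) (v : Fin K → Bool) (x y : ℝ) :
    |hardBump K v x - hardBump K v y| ≤ 2 * |x - y| := by
  have hs : ∀ j, |sgnB (v j) * binHat K j x - sgnB (v j) * binHat K j y| ≤ |x - y| := fun j => by
    rw [← mul_sub, abs_mul, abs_sgnB, one_mul]
    exact abs_binHat_sub_le j x y
  obtain ⟨i, hi⟩ := exists_binHat_support hK x
  obtain ⟨k, hk⟩ := exists_binHat_support hK y
  rw [hardBump_eq hi, hardBump_eq hk]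
  by_cases hik : k = i
  · subst hik
    linarith [hs k, abs_nonneg (x - y)]
  · have h1 := hs i
    have h2 := hs k
    rw [hk i (Ne.symm hik), mul_zero, sub_zero] at h1
    rw [hi k hik, mul_zero, zero_sub, abs_neg] at h2
    linarith [abs_sub (sgnB (v i) * binHat K i x) (sgnB (v k) * binHat K k y)]

lemma measurable_hardEta (K : ℕ) (v : Fin K → Bool) : Measurable (hardEta K v) := by
  have h : hardEta K v = fun x => (1/2) * (1 + hardBump K v x) := funext (hardEta_eq K v)
  rw [h]
  exact ((measurable_hardBump K v).const_add _).const_mul _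

lemma hardEta_mem {K : ℕ} (hK : 0 < K) (v : Fin K → Bool) (x : ℝ) :
    hardEta K v x ∈ Icc (1/4 : ℝ) (3/4) := by
  have h := abs_le.1 (abs_hardBump_le hK v x)
  rw [hardEta_eq]
  constructor <;> linarith [h.1, h.2]

lemma lipschitzWith_hardEta {K : ℕ} (hK : 0 < K) (v : Fin K → Bool) :
    LipschitzWith 1 (hardEta K v) :=
  LipschitzWith.of_dist_le_mul fun x y => by
    rw [NNReal.coe_one, one_mul, Real.dist_eq, Real.dist_eq, hardEta_eq, hardEta_eq]
    have h := abs_le.1 (abs_hardBump_sub_le hK v x y)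
    rw [abs_le]
    constructor <;> linarith [h.1, h.2]

lemma integral_abs_hatFun {K : ℕ} (hK : 0 < K) :
    ∫ x in (-(1/(2*(K:ℝ))))..(1/(2*(K:ℝ))), |hatFun K x| = 1/(8*(K:ℝ)^2) := by
  have ha : 0 < 1/(4*(K:ℝ)) := by positivity
  have h2 : 1/(2*(K:ℝ)) = 2 * (1/(4*(K:ℝ))) := by field_simp; norm_num
  have h8 : 1/(8*(K:ℝ)^2) = 2 * (1/(4*(K:ℝ)))^2 := by field_simp; norm_num
  have hc : Continuous fun x => |hatFun K x| := (lipschitzWith_hatFun hK).continuous.abs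
  have hi : ∀ p q : ℝ, IntervalIntegrable (fun x => |hatFun K x|) volume p q := fun p q =>
    hc.intervalIntegrable p q
  have hat := hatFun_eq_max_min hK
  rw [h8]
  simp only [h2] at hat ⊢
  generalize 1/(4*(K:ℝ)) = a at *
  have e1 : ∫ x in (-(2*a))..(-a), |hatFun K x| = ∫ x in (-(2*a))..(-a), (x + 2*a) := by
    refine intervalIntegral.integral_congr fun x hx => ?_
    rw [uIcc_of_le (by linarith)] at hx
    simp only [hat, max_def, min_def]
    rcases hx with ⟨hx1, hx2⟩
    split_ifs <;> grind
  have e2 : ∫ x in (-a)..0, |hatFun K x| = ∫ x in (-a)..0, -x := by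
    refine intervalIntegral.integral_congr fun x hx => ?_
    rw [uIcc_of_le (by linarith)] at hx
    simp only [hat, max_def, min_def]
    rcases hx with ⟨hx1, hx2⟩
    split_ifs <;> grind
  have e3 : ∫ x in (0:ℝ)..a, |hatFun K x| = ∫ x in (0:ℝ)..a, x := by
    refine intervalIntegral.integral_congr fun x hx => ?_
    rw [uIcc_of_le (by linarith)] at hx
    simp only [hat, max_def, min_def]
    rcases hx with ⟨hx1, hx2⟩
    split_ifs <;> grind
  have e4 : ∫ x in a..(2*a), |hatFun K x| = ∫ x in a..(2*a), (2*a - x) := by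
    refine intervalIntegral.integral_congr fun x hx => ?_
    rw [uIcc_of_le (by linarith)] at hx
    simp only [hat, max_def, min_def]
    rcases hx with ⟨hx1, hx2⟩
    split_ifs <;> grind
  rw [← intervalIntegral.integral_add_adjacent_intervals (hi (-(2*a)) (-a)) (hi (-a) (2*a)),
    ← intervalIntegral.integral_add_adjacent_intervals (hi (-a) 0) (hi 0 (2*a)),
    ← intervalIntegral.integral_add_adjacent_intervals (hi 0 a) (hi a (2*a)), e1, e2, e3, e4]
  have ic : ∀ {g : ℝ → ℝ}, Continuous g → ∀ p q : ℝ, IntervalIntegrable g volume p q :=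
    fun hg p q => hg.intervalIntegrable p q
  rw [intervalIntegral.integral_add (ic continuous_id' _ _) (ic continuous_const _ _),
    intervalIntegral.integral_sub (ic continuous_const _ _) (ic continuous_id' _ _),
    intervalIntegral.integral_neg]
  simp only [integral_id, intervalIntegral.integral_const, smul_eq_mul]
  ring

lemma integral_abs_binHat {K : ℕ} (j : Fin K) :
    ∫ x in Icc (0:ℝ) 1, |binHat K j x| = 1/(8*(K:ℝ)^2) := by
  have hK : 0 < K := j.pos
  have hK' : (0:ℝ) < K := by exact_mod_cast hK
  have h1 : (j:ℝ)/(K:ℝ) = ((j:ℝ) + 1/2)/(K:ℝ) - 1/(2*(K:ℝ)) := by field_simp; ring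
  have h2 : ((j:ℝ)+1)/(K:ℝ) = ((j:ℝ) + 1/2)/(K:ℝ) + 1/(2*(K:ℝ)) := by field_simp; ring
  have hsub : Ico ((j:ℝ)/(K:ℝ)) (((j:ℝ)+1)/(K:ℝ)) ⊆ Icc (0:ℝ) 1 := fun x hx => by
    refine ⟨le_trans (by positivity) hx.1, hx.2.le.trans ?_⟩
    rw [div_le_one hK']
    exact_mod_cast j.2
  have hle : (j:ℝ)/(K:ℝ) ≤ ((j:ℝ)+1)/(K:ℝ) := by gcongr; linarith
  have h3 : ∫ x in Icc (0:ℝ) 1, |binHat K j x|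
      = ∫ x in Ico ((j:ℝ)/(K:ℝ)) (((j:ℝ)+1)/(K:ℝ)), |binHat K j x| := by
    refine setIntegral_eq_of_subset_of_forall_sdiff_eq_zero measurableSet_Icc hsub fun x hx => ?_
    rw [binHat, if_neg hx.2, abs_zero]
  rw [h3, integral_Ico_eq_integral_Ioo, ← integral_Ioc_eq_integral_Ioo,
    ← intervalIntegral.integral_of_le hle]
  simp only [binHat_eq]
  rw [intervalIntegral.integral_comp_sub_right (fun x => |hatFun K x|), h1, h2,
    ← integral_abs_hatFun hK]
  congr 1 <;> ring

lemma labelMeasure_apply (g : ℝ → ℝ) (y : Bool) {s : Set (ℝ × Bool)} (hs : MeasurableSet s) :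
    labelMeasure g y s
      = ∫⁻ x in (fun x => (x, y)) ⁻¹' s, ENNReal.ofReal (g x) ∂(volume.restrict (Icc (0:ℝ) 1)) := by
  have hm : Measurable fun x : ℝ => (x, y) := measurable_id.prodMk measurable_const
  rw [labelMeasure, Measure.map_apply hm hs, withDensity_apply _ (hm hs)]

lemma isProbabilityMeasure_covMeasure {p η : ℝ → ℝ} (hp : ∀ x, 0 ≤ p x)
    (hp1 : (∫ x in Icc (0:ℝ) 1, p x) = 1) (hη : ∀ x, 0 ≤ η x ∧ η x ≤ 1)
    (hηm : AEMeasurable η (volume.restrict (Icc (0:ℝ) 1))) :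
    IsProbabilityMeasure (covMeasure p η) := by
  have hpi : Integrable p (volume.restrict (Icc (0:ℝ) 1)) := by
    by_contra h
    rw [integral_undef h] at hp1
    exact zero_ne_one hp1
  refine ⟨?_⟩
  rw [covMeasure, Measure.add_apply, labelMeasure_apply _ _ MeasurableSet.univ,
    labelMeasure_apply _ _ MeasurableSet.univ, preimage_univ, preimage_univ,
    Measure.restrict_univ,
    ← lintegral_add_left' (f := fun x => ENNReal.ofReal (p x * η x))
      (hpi.aemeasurable.mul hηm).ennreal_ofReal]
  have h : ∀ x, ENNReal.ofReal (p x * η x) + ENNReal.ofReal (p x * (1 - η x))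
      = ENNReal.ofReal (p x) := fun x => by
    rw [← ENNReal.ofReal_add (mul_nonneg (hp x) (hη x).1)
      (mul_nonneg (hp x) (sub_nonneg.2 (hη x).2))]
    congr 1
    ring
  simp only [h]
  rw [← ofReal_integral_eq_lintegral_ofReal hpi (ae_of_all _ hp), hp1, ENNReal.ofReal_one]

lemma measurableSet_misclassified {f : ℝ → Bool} (hf : Measurable f) :
    MeasurableSet {p : ℝ × Bool | f p.1 ≠ p.2} :=
  (measurableSet_eq_fun (hf.comp measurable_fst) measurable_snd).compl

lemma toReal_labelMeasure_misclassified {g : ℝ → ℝ} (hg : ∀ x, 0 ≤ g x)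
    (hgi : Integrable g (volume.restrict (Icc (0:ℝ) 1))) {f : ℝ → Bool} (hf : Measurable f)
    (y : Bool) :
    (labelMeasure g y {p : ℝ × Bool | f p.1 ≠ p.2}).toReal
      = ∫ x in Icc (0:ℝ) 1, if f x = y then 0 else g x := by
  have hs : MeasurableSet {x | f x ≠ y} := (hf (measurableSet_singleton y)).compl
  rw [labelMeasure_apply _ _ (measurableSet_misclassified hf)]
  change (∫⁻ x in {x | f x ≠ y}, ENNReal.ofReal (g x) ∂_).toReal = _
  rw [← ofReal_integral_eq_lintegral_ofReal hgi.integrableOn (ae_of_all _ hg),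
    ENNReal.toReal_ofReal (integral_nonneg hg), ← integral_indicator hs]
  refine integral_congr_ae (ae_of_all _ fun x => ?_)
  by_cases h : f x = y <;> simp [indicator, h]

lemma risk_covMeasure {p η : ℝ → ℝ} (hp : ∀ x, 0 ≤ p x)
    (hp1 : (∫ x in Icc (0:ℝ) 1, p x) = 1) (hη : ∀ x, 0 ≤ η x ∧ η x ≤ 1) (hηm : Measurable η)
    {f : ℝ → Bool} (hf : Measurable f) :
    Integrable (fun x => p x * bif f x then 1 - η x else η x) (volume.restrict (Icc (0:ℝ) 1)) ∧
    risk f (covMeasure p η) = ∫ x in Icc (0:ℝ) 1, p x * bif f x then 1 - η x else η x := by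
  have hpi : Integrable p (volume.restrict (Icc (0:ℝ) 1)) := by
    by_contra h
    rw [integral_undef h] at hp1
    exact zero_ne_one hp1
  have := isProbabilityMeasure_covMeasure hp hp1 hη hηm.aemeasurable
  have hb : ∀ x, |η x| ≤ 1 := fun x => abs_le.2 ⟨by linarith [(hη x).1], (hη x).2⟩
  have hb' : ∀ x, |1 - η x| ≤ 1 := fun x =>
    abs_le.2 ⟨by linarith [(hη x).2], by linarith [(hη x).1]⟩
  have h1 : Integrable (fun x => p x * η x) (volume.restrict (Icc (0:ℝ) 1)) :=
    hpi.mul_bdd (c := 1) hηm.aestronglyMeasurable (ae_of_all _ hb)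
  have h2 : Integrable (fun x => p x * (1 - η x)) (volume.restrict (Icc (0:ℝ) 1)) :=
    hpi.mul_bdd (c := 1) (hηm.const_sub 1).aestronglyMeasurable (ae_of_all _ hb')
  have hs : ∀ y, MeasurableSet {x | f x = y} := fun y => hf (measurableSet_singleton y)
  have i1 : Integrable (fun x => if f x = true then 0 else p x * η x)
      (volume.restrict (Icc (0:ℝ) 1)) := by
    refine (h1.indicator (hs true).compl).congr (ae_of_all _ fun x => ?_)
    by_cases h : f x = true <;> simp [indicator, h]
  have i2 : Integrable (fun x => if f x = false then 0 else p x * (1 - η x))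
      (volume.restrict (Icc (0:ℝ) 1)) := by
    refine (h2.indicator (hs false).compl).congr (ae_of_all _ fun x => ?_)
    by_cases h : f x = false <;> simp [indicator, h]
  have hsum : ∀ x, (if f x = true then 0 else p x * η x)
      + (if f x = false then 0 else p x * (1 - η x)) = p x * bif f x then 1 - η x else η x := by
    intro x
    cases f x <;> simp
  refine ⟨(i1.add i2).congr (ae_of_all _ hsum), ?_⟩
  have hfin : ∀ s, labelMeasure (fun x => p x * η x) true s ≠ ∞ ∧
      labelMeasure (fun x => p x * (1 - η x)) false s ≠ ∞ := fun s => by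
    have := measure_ne_top (covMeasure p η) s
    rw [covMeasure, Measure.add_apply, ENNReal.add_ne_top] at this
    exact this
  rw [risk, covMeasure, Measure.add_apply, ENNReal.toReal_add (hfin _).1 (hfin _).2,
    toReal_labelMeasure_misclassified (fun x => mul_nonneg (hp x) (hη x).1) h1 hf,
    toReal_labelMeasure_misclassified (fun x => mul_nonneg (hp x) (sub_nonneg.2 (hη x).2)) h2 hf,
    ← integral_add i1 i2]
  exact integral_congr_ae (ae_of_all _ hsum)

lemma risk_testMeasure (f : ℝ → Bool) (P Q : Measure (ℝ × Bool)) [IsFiniteMeasure P]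
    [IsFiniteMeasure Q] : risk f (testMeasure P Q) = (risk f P + risk f Q) / 2 := by
  simp only [risk, testMeasure, Measure.add_apply, Measure.smul_apply, smul_eq_mul]
  rw [ENNReal.toReal_add (ENNReal.mul_ne_top (by simp) (measure_ne_top _ _))
    (ENNReal.mul_ne_top (by simp) (measure_ne_top _ _))]
  simp
  ring

lemma labelMeasure_le_smul {g g' : ℝ → ℝ} {c : NNReal} (h : ∀ x, g x ≤ c * g' x) (y : Bool) :
    labelMeasure g y ≤ c • labelMeasure g' y := by
  refine Measure.le_iff.2 fun s hs => ?_
  rw [Measure.smul_apply, labelMeasure_apply _ _ hs, labelMeasure_apply _ _ hs,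
    ENNReal.smul_def, smul_eq_mul, ← lintegral_const_mul' _ _ ENNReal.coe_ne_top]
  refine lintegral_mono fun x => ?_
  rw [← ENNReal.ofReal_coe_nnreal, ← ENNReal.ofReal_mul c.coe_nonneg]
  exact ENNReal.ofReal_le_ofReal (h x)

lemma covMeasure_le_smul {p η η' : ℝ → ℝ} {c : NNReal} (hp : ∀ x, 0 ≤ p x)
    (h1 : ∀ x, η x ≤ c * η' x) (h2 : ∀ x, 1 - η x ≤ c * (1 - η' x)) :
    covMeasure p η ≤ c • covMeasure p η' := by
  rw [covMeasure, covMeasure, smul_add]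
  refine add_le_add (labelMeasure_le_smul (fun x => ?_) _) (labelMeasure_le_smul (fun x => ?_) _)
  · calc p x * η x ≤ p x * (c * η' x) := mul_le_mul_of_nonneg_left (h1 x) (hp x)
      _ = c * (p x * η' x) := by ring
  · calc p x * (1 - η x) ≤ p x * (c * (1 - η' x)) := mul_le_mul_of_nonneg_left (h2 x) (hp x)
      _ = c * (p x * (1 - η' x)) := by ring

lemma measure_pi_mono {ι α : Type*} [Fintype ι] [MeasurableSpace α] {μ ν : Measure α}
    (h : μ ≤ ν) : Measure.pi (fun _ : ι => μ) ≤ Measure.pi (fun _ : ι => ν) := by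
  refine Measure.le_iff.2 fun s hs => ?_
  rw [Measure.pi, Measure.pi, toMeasure_apply _ _ hs, toMeasure_apply _ _ hs]
  have h1 : OuterMeasure.pi (fun _ : ι => μ.toOuterMeasure)
      ≤ OuterMeasure.pi (fun _ : ι => ν.toOuterMeasure) :=
    OuterMeasure.le_pi.2 fun t _ => (OuterMeasure.pi_pi_le _ t).trans
      (Finset.prod_le_prod' fun i _ => h (t i))
  exact h1 s

lemma measure_pi_smul {ι α : Type*} [Fintype ι] [MeasurableSpace α] (μ : Measure α)
    [SigmaFinite μ] (c : NNReal) :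
    Measure.pi (fun _ : ι => c • μ) = c ^ Fintype.card ι • Measure.pi (fun _ : ι => μ) := by
  refine Measure.pi_eq fun s _ => ?_
  simp only [ENNReal.smul_def, Measure.smul_apply, smul_eq_mul, Measure.pi_pi,
    Finset.prod_mul_distrib, Finset.prod_const, Finset.card_univ, ENNReal.coe_pow]

lemma sampleMeasure_le_smul {nmaj nmin : ℕ} {P P' Q Q' : Measure (ℝ × Bool)}
    [IsProbabilityMeasure P'] [IsProbabilityMeasure Q] [IsProbabilityMeasure Q'] {c : NNReal}
    (hP : P ≤ c • P') (hQ : Q ≤ c • Q') :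
    sampleMeasure nmaj nmin P Q ≤ c ^ (nmaj + nmin) • sampleMeasure nmaj nmin P' Q' := by
  have h1 : Measure.pi (fun _ : Fin nmaj => P) ≤ c ^ nmaj • Measure.pi fun _ : Fin nmaj => P' := by
    simpa [measure_pi_smul] using measure_pi_mono (ι := Fin nmaj) hP
  have h2 : Measure.pi (fun _ : Fin nmin => Q) ≤ c ^ nmin • Measure.pi fun _ : Fin nmin => Q' := by
    simpa [measure_pi_smul] using measure_pi_mono (ι := Fin nmin) hQ
  refine (Measure.prod_mono h1 h2).trans_eq ?_
  refine Measure.ext fun s hs => ?_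
  simp only [sampleMeasure, ENNReal.smul_def]
  rw [Measure.prod_smul_left, Measure.prod_smul_right, smul_smul, pow_add, ENNReal.coe_mul]

lemma setIntegral_step (a b : ℝ) :
    ∫ x in Icc (0:ℝ) 1, (if x < 1/2 then a else b) = (a + b) / 2 := by
  have hu : Icc (0:ℝ) 1 = Ico 0 (1/2) ∪ Icc (1/2) 1 :=
    (Ico_union_Icc_eq_Icc (by norm_num) (by norm_num)).symm
  have hd : Disjoint (Ico (0:ℝ) (1/2)) (Icc (1/2) 1) :=
    disjoint_left.2 fun x hx hx' => absurd hx.2 (not_lt.2 hx'.1)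
  have h1 : EqOn (fun x : ℝ => if x < 1/2 then a else b) (fun _ => a) (Ico 0 (1/2)) :=
    fun x hx => if_pos hx.2
  have h2 : EqOn (fun x : ℝ => if x < 1/2 then a else b) (fun _ => b) (Icc (1/2) 1) :=
    fun x hx => if_neg (not_lt.2 hx.1)
  have i1 : IntegrableOn (fun x : ℝ => if x < 1/2 then a else b) (Ico 0 (1/2)) :=
    (integrableOn_congr_fun h1 measurableSet_Ico).2 (integrableOn_const (by simp))
  have i2 : IntegrableOn (fun x : ℝ => if x < 1/2 then a else b) (Icc (1/2) 1) :=
    (integrableOn_congr_fun h2 measurableSet_Icc).2 (integrableOn_const (by simp))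
  rw [hu, setIntegral_union hd measurableSet_Icc i1 i2, setIntegral_congr_fun measurableSet_Ico h1,
    setIntegral_congr_fun measurableSet_Icc h2]
  simp only [setIntegral_const, Real.volume_real_Ico, Real.volume_real_Icc, smul_eq_mul]
  norm_num
  ring

lemma hardPb_eq (τ x : ℝ) : hardPb τ x = if x < 1/2 then τ else 2 - τ := by
  unfold hardPb hardPa
  split_ifs <;> ring

lemma hardPa_nonneg {τ : ℝ} (hτ : τ ∈ Icc (0:ℝ) 1) (x : ℝ) : 0 ≤ hardPa τ x := by
  unfold hardPa
  split_ifs <;> linarith [hτ.1, hτ.2]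

lemma hardPb_nonneg {τ : ℝ} (hτ : τ ∈ Icc (0:ℝ) 1) (x : ℝ) : 0 ≤ hardPb τ x := by
  rw [hardPb_eq]
  split_ifs <;> linarith [hτ.1, hτ.2]

lemma integral_hardPa (τ : ℝ) : ∫ x in Icc (0:ℝ) 1, hardPa τ x = 1 := by
  simp only [hardPa, setIntegral_step]
  ring

lemma integral_hardPb (τ : ℝ) : ∫ x in Icc (0:ℝ) 1, hardPb τ x = 1 := by
  simp only [hardPb_eq, setIntegral_step]
  ring

lemma hardEta_bounds {K : ℕ} (hK : 0 < K) (v : Fin K → Bool) (x : ℝ) :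
    0 ≤ hardEta K v x ∧ hardEta K v x ≤ 1 := by
  have h := hardEta_mem hK v x
  constructor <;> linarith [h.1, h.2]

lemma tvDist_hard {τ : ℝ} (hτ : τ ∈ Icc (0:ℝ) 1) : tvDist (hardPa τ) (hardPb τ) = 1 - τ := by
  have h : ∀ x, |hardPa τ x - hardPb τ x| = if x < 1/2 then 2 - 2*τ else 2 - 2*τ := fun x => by
    rw [hardPb_eq, hardPa]
    split_ifs
    · rw [abs_of_nonneg] <;> linarith [hτ.2]
    · rw [abs_of_nonpos] <;> linarith [hτ.2]
  simp only [tvDist, h, setIntegral_step]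
  ring

lemma memGS_hard {K : ℕ} (hK : 0 < K) {τ : ℝ} (hτ : τ ∈ Icc (0:ℝ) 1) (v : Fin K → Bool) :
    memGS τ (covMeasure (hardPa τ) (hardEta K v)) (covMeasure (hardPb τ) (hardEta K v)) := by
  refine ⟨hardPa τ, hardPb τ, hardEta K v, hardPa_nonneg hτ, hardPb_nonneg hτ, integral_hardPa τ,
    integral_hardPb τ, hardEta_bounds hK v, (lipschitzWith_hardEta hK v).lipschitzOnWith, ?_, ?_,
    rfl, rfl⟩
  · have h : LipschitzWith 1 fun x => 1 - hardEta K v x := by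
      simpa using (LipschitzWith.const (1:ℝ)).sub (lipschitzWith_hardEta hK v)
    exact h.lipschitzOnWith
  · rw [tvDist_hard hτ]
    linarith

lemma isProbabilityMeasure_of_memGS {τ : ℝ} {P Q : Measure (ℝ × Bool)} (h : memGS τ P Q) :
    IsProbabilityMeasure P ∧ IsProbabilityMeasure Q := by
  obtain ⟨pa, pb, η, ha, hb, ha1, hb1, hη, hL, -, -, rfl, rfl⟩ := h
  have hm : AEMeasurable η (volume.restrict (Icc (0:ℝ) 1)) :=
    hL.continuousOn.aemeasurable measurableSet_Icc
  exact ⟨isProbabilityMeasure_covMeasure ha ha1 hη hm, isProbabilityMeasure_covMeasure hb hb1 hη hm⟩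

lemma isProbabilityMeasure_sampleMeasure (nmaj nmin : ℕ) (P Q : Measure (ℝ × Bool))
    [IsProbabilityMeasure P] [IsProbabilityMeasure Q] :
    IsProbabilityMeasure (sampleMeasure nmaj nmin P Q) := by
  unfold sampleMeasure
  infer_instance

lemma risk_nonneg (f : ℝ → Bool) (P : Measure (ℝ × Bool)) : 0 ≤ risk f P :=
  ENNReal.toReal_nonneg

lemma bddBelow_risk (P : Measure (ℝ × Bool)) : BddBelow (range fun f : ℝ → Bool => risk f P) :=
  ⟨0, by rintro _ ⟨f, rfl⟩; exact risk_nonneg f P⟩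

lemma risk_testMeasure_le_one (f : ℝ → Bool) (P Q : Measure (ℝ × Bool)) [IsProbabilityMeasure P]
    [IsProbabilityMeasure Q] : risk f (testMeasure P Q) ≤ 1 := by
  have h1 : risk f P ≤ 1 := measureReal_le_one
  have h2 : risk f Q ≤ 1 := measureReal_le_one
  rw [risk_testMeasure]
  linarith

lemma excessRisk_le_one {nmaj nmin : ℕ} (A : Sample nmaj nmin → ℝ → Bool)
    (P Q : Measure (ℝ × Bool)) [IsProbabilityMeasure P] [IsProbabilityMeasure Q] :
    excessRisk nmaj nmin A P Q ≤ 1 := by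
  have := isProbabilityMeasure_sampleMeasure nmaj nmin P Q
  have h1 : ∫ S, risk (A S) (testMeasure P Q) ∂sampleMeasure nmaj nmin P Q ≤ 1 := by
    have := norm_integral_le_of_norm_le_const (μ := sampleMeasure nmaj nmin P Q)
      (f := fun S => risk (A S) (testMeasure P Q)) (C := 1) (ae_of_all _ fun S => by
        rw [Real.norm_eq_abs, abs_of_nonneg (risk_nonneg _ _)]
        exact risk_testMeasure_le_one _ P Q)
    rw [probReal_univ, mul_one] at this
    exact (le_abs_self _).trans this
  have h2 : 0 ≤ bayesRisk (testMeasure P Q) := Real.iInf_nonneg fun f => risk_nonneg f _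
  unfold excessRisk
  linarith

lemma measurable_sgnB : Measurable sgnB := measurable_of_countable sgnB

/-- The contribution of the bin `j` to the excess risk of `f` when the sign of the perturbation
on this bin is `b`. -/
def binLoss (K : ℕ) (f : ℝ → Bool) (j : Fin K) (b : Bool) : ℝ :=
  ∫ x in Icc (0:ℝ) 1, (|binHat K j x| - sgnB (f x) * (sgnB b * binHat K j x)) / 2

lemma integrable_binHat {K : ℕ} (j : Fin K) :
    Integrable (binHat K j) (volume.restrict (Icc (0:ℝ) 1)) :=
  Integrable.of_bound (measurable_binHat j).aestronglyMeasurable (1/4)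
    (ae_of_all _ (abs_binHat_le j))

lemma integrable_sgnB_mul {f : ℝ → Bool} (hf : Measurable f) {g : ℝ → ℝ} {μ : Measure ℝ}
    (hg : Integrable g μ) : Integrable (fun x => sgnB (f x) * g x) μ :=
  hg.bdd_mul (c := 1) (measurable_sgnB.comp hf).aestronglyMeasurable
    (ae_of_all _ fun x => (abs_sgnB (f x)).le)

lemma integrable_binLoss {K : ℕ} {f : ℝ → Bool} (hf : Measurable f) (j : Fin K) (b : Bool) :
    Integrable (fun x => (|binHat K j x| - sgnB (f x) * (sgnB b * binHat K j x)) / 2)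
      (volume.restrict (Icc (0:ℝ) 1)) :=
  ((integrable_binHat j).abs.sub
    (integrable_sgnB_mul hf ((integrable_binHat j).const_mul _))).div_const 2

lemma binLoss_nonneg {K : ℕ} (f : ℝ → Bool) (j : Fin K) (b : Bool) : 0 ≤ binLoss K f j b :=
  integral_nonneg fun x => by
    have h : |sgnB (f x) * (sgnB b * binHat K j x)| = |binHat K j x| := by
      rw [abs_mul, abs_mul, abs_sgnB, abs_sgnB, one_mul, one_mul]
    have := le_abs_self (sgnB (f x) * (sgnB b * binHat K j x))
    simp only [Pi.zero_apply]
    linarith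

lemma binLoss_true_add_false {K : ℕ} {f : ℝ → Bool} (hf : Measurable f) (j : Fin K) :
    binLoss K f j true + binLoss K f j false = 1/(8*(K:ℝ)^2) := by
  rw [binLoss, binLoss, ← integral_add (integrable_binLoss hf j _) (integrable_binLoss hf j _),
    ← integral_abs_binHat j]
  refine integral_congr_ae (ae_of_all _ fun x => ?_)
  simp [sgnB]
  ring

lemma measurable_binLoss {nmaj nmin K : ℕ} {A : Sample nmaj nmin → ℝ → Bool}
    (hA : MeasurableAlg nmaj nmin A) (j : Fin K) (b : Bool) :
    Measurable fun S => binLoss K (A S) j b := by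
  have h : Measurable fun p : Sample nmaj nmin × ℝ =>
      (|binHat K j p.2| - sgnB (A p.1 p.2) * (sgnB b * binHat K j p.2)) / 2 := by
    have h1 : Measurable fun p : Sample nmaj nmin × ℝ => binHat K j p.2 :=
      (measurable_binHat j).comp measurable_snd
    have h2 : Measurable fun p : Sample nmaj nmin × ℝ => sgnB (A p.1 p.2) :=
      measurable_sgnB.comp hA
    exact ((continuous_abs.measurable.comp h1).sub (h2.mul (h1.const_mul _))).div_const 2
  exact (h.stronglyMeasurable.integral_prod_right (ν := volume.restrict (Icc (0:ℝ) 1))).measurable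

lemma MeasurableAlg.measurable_apply {nmaj nmin : ℕ} {A : Sample nmaj nmin → ℝ → Bool}
    (hA : MeasurableAlg nmaj nmin A) (S : Sample nmaj nmin) : Measurable (A S) :=
  hA.comp measurable_prodMk_left

/-- The balanced test distribution of the hard instance indexed by `v`. -/
def hardTest (K : ℕ) (τ : ℝ) (v : Fin K → Bool) : Measure (ℝ × Bool) :=
  testMeasure (covMeasure (hardPa τ) (hardEta K v)) (covMeasure (hardPb τ) (hardEta K v))

lemma risk_hardTest {K : ℕ} (hK : 0 < K) {τ : ℝ} (hτ : τ ∈ Icc (0:ℝ) 1) (v : Fin K → Bool)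
    {f : ℝ → Bool} (hf : Measurable f) :
    risk f (hardTest K τ v) = ∫ x in Icc (0:ℝ) 1, (1 - sgnB (f x) * hardBump K v x) / 2 := by
  have hP := isProbabilityMeasure_of_memGS (memGS_hard hK hτ v)
  have := hP.1
  have := hP.2
  have ha := risk_covMeasure (hardPa_nonneg hτ) (integral_hardPa τ) (hardEta_bounds hK v)
    (measurable_hardEta K v) hf
  have hb := risk_covMeasure (hardPb_nonneg hτ) (integral_hardPb τ) (hardEta_bounds hK v)
    (measurable_hardEta K v) hf
  rw [hardTest, risk_testMeasure, ha.2, hb.2, ← integral_add ha.1 hb.1, ← integral_div]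
  refine integral_congr_ae (ae_of_all _ fun x => ?_)
  simp only [hardPb, hardEta_eq]
  cases f x <;> simp [sgnB] <;> ring

lemma sum_binLoss_le {K : ℕ} (hK : 0 < K) {τ : ℝ} (hτ : τ ∈ Icc (0:ℝ) 1) (v : Fin K → Bool)
    {f : ℝ → Bool} (hf : Measurable f) :
    ∑ j, binLoss K f j (v j) ≤ risk f (hardTest K τ v) - bayesRisk (hardTest K τ v) := by
  set g : ℝ → Bool := fun x => decide (0 ≤ hardBump K v x) with hg
  have hgm : Measurable g := by
    refine measurable_to_bool ?_
    have h : g ⁻¹' {true} = {x | 0 ≤ hardBump K v x} := by ext x; simp [hg]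
    rw [h]
    exact measurableSet_le measurable_const (measurable_hardBump K v)
  have hbayes : bayesRisk (hardTest K τ v) ≤ risk g (hardTest K τ v) :=
    ciInf_le (bddBelow_risk _) g
  have hbi : Integrable (hardBump K v) (volume.restrict (Icc (0:ℝ) 1)) :=
    Integrable.of_bound (measurable_hardBump K v).aestronglyMeasurable (1/4)
      (ae_of_all _ (abs_hardBump_le hK v))
  have hint : ∀ {f : ℝ → Bool}, Measurable f →
      Integrable (fun x => (1 - sgnB (f x) * hardBump K v x) / 2)
        (volume.restrict (Icc (0:ℝ) 1)) := fun hf =>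
    ((integrable_const 1).sub (integrable_sgnB_mul hf hbi)).div_const 2
  have hsum : ∑ j, binLoss K f j (v j) = risk f (hardTest K τ v) - risk g (hardTest K τ v) := by
    unfold binLoss
    rw [risk_hardTest hK hτ v hf, risk_hardTest hK hτ v hgm, ← integral_sub (hint hf) (hint hgm),
      ← integral_finsetSum _ fun j _ => integrable_binLoss hf j _]
    refine integral_congr_ae (ae_of_all _ fun x => ?_)
    have h1 : sgnB (g x) * hardBump K v x = |hardBump K v x| := by
      by_cases h : 0 ≤ hardBump K v x
      · simp [hg, h, sgnB, abs_of_nonneg h]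
      · simp [hg, h, sgnB, abs_of_neg (not_le.1 h)]
    simp only [h1]
    rw [← Finset.sum_div, Finset.sum_sub_distrib, ← abs_hardBump hK v, ← Finset.mul_sum]
    simp only [hardBump]
    ring
  linarith

lemma hardGS_isProbabilityMeasure {K : ℕ} (hK : 0 < K) (nmaj nmin : ℕ) {τ : ℝ}
    (hτ : τ ∈ Icc (0:ℝ) 1) (v : Fin K → Bool) :
    IsProbabilityMeasure (hardGSMeasure K nmaj nmin τ v) := by
  have hP := isProbabilityMeasure_of_memGS (memGS_hard hK hτ v)
  have := hP.1
  have := hP.2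
  exact isProbabilityMeasure_sampleMeasure nmaj nmin _ _

lemma binLoss_le {K : ℕ} {f : ℝ → Bool} (hf : Measurable f) (j : Fin K) (b : Bool) :
    binLoss K f j b ≤ 1/(8*(K:ℝ)^2) := by
  have h := binLoss_true_add_false hf j
  have h1 := binLoss_nonneg f j true
  have h2 := binLoss_nonneg f j false
  cases b <;> linarith

lemma integrable_binLoss_sample {nmaj nmin K : ℕ} {A : Sample nmaj nmin → ℝ → Bool}
    (hA : MeasurableAlg nmaj nmin A) (j : Fin K) (b : Bool) (μ : Measure (Sample nmaj nmin))
    [IsFiniteMeasure μ] : Integrable (fun S => binLoss K (A S) j b) μ :=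
  Integrable.of_bound (measurable_binLoss hA j b).aestronglyMeasurable (1/(8*(K:ℝ)^2))
    (ae_of_all _ fun S => by
      rw [Real.norm_eq_abs, abs_of_nonneg (binLoss_nonneg _ j b)]
      exact binLoss_le (hA.measurable_apply S) j b)

lemma sum_integral_binLoss_le_excessRisk {nmaj nmin K : ℕ} (hK : 0 < K) {τ : ℝ}
    (hτ : τ ∈ Icc (0:ℝ) 1) {A : Sample nmaj nmin → ℝ → Bool} (hA : MeasurableAlg nmaj nmin A)
    (v : Fin K → Bool) :
    ∑ j, ∫ S, binLoss K (A S) j (v j) ∂hardGSMeasure K nmaj nmin τ v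
      ≤ excessRisk nmaj nmin A (covMeasure (hardPa τ) (hardEta K v))
          (covMeasure (hardPb τ) (hardEta K v)) := by
  have := hardGS_isProbabilityMeasure hK nmaj nmin hτ v
  have hP := isProbabilityMeasure_of_memGS (memGS_hard hK hτ v)
  have := hP.1
  have := hP.2
  have hrm : Measurable fun S => risk (A S) (hardTest K τ v) := by
    have h : Measurable fun p : Sample nmaj nmin × ℝ =>
        (1 - sgnB (A p.1 p.2) * hardBump K v p.2) / 2 :=
      (((measurable_sgnB.comp hA).mul
        ((measurable_hardBump K v).comp measurable_snd)).const_sub 1).div_const 2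
    have h' := (h.stronglyMeasurable.integral_prod_right'
      (ν := volume.restrict (Icc (0:ℝ) 1))).measurable
    simpa only [risk_hardTest hK hτ v (hA.measurable_apply _)] using h'
  have hri : Integrable (fun S => risk (A S) (hardTest K τ v)) (hardGSMeasure K nmaj nmin τ v) :=
    Integrable.of_bound hrm.aestronglyMeasurable 1 (ae_of_all _ fun S => by
      rw [Real.norm_eq_abs, abs_of_nonneg (risk_nonneg _ _)]
      exact risk_testMeasure_le_one _ _ _)
  have hex : excessRisk nmaj nmin A (covMeasure (hardPa τ) (hardEta K v))
          (covMeasure (hardPb τ) (hardEta K v))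
      = ∫ S, (risk (A S) (hardTest K τ v) - bayesRisk (hardTest K τ v))
          ∂hardGSMeasure K nmaj nmin τ v := by
    rw [integral_sub hri (integrable_const _), integral_const, probReal_univ, one_smul]
    rfl
  rw [hex, ← integral_finsetSum _ fun j _ => integrable_binLoss_sample hA j (v j) _]
  exact integral_mono (integrable_finsetSum _ fun j _ => integrable_binLoss_sample hA j (v j) _)
    (hri.sub (integrable_const _)) fun S => sum_binLoss_le hK hτ v (hA.measurable_apply S)

lemma hardGSMeasure_le_smul {K : ℕ} (hK : 0 < K) (nmaj nmin : ℕ) {τ : ℝ} (hτ : τ ∈ Icc (0:ℝ) 1)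
    (v w : Fin K → Bool) :
    hardGSMeasure K nmaj nmin τ v ≤ (3:NNReal) ^ (nmaj + nmin) • hardGSMeasure K nmaj nmin τ w := by
  have hv := isProbabilityMeasure_of_memGS (memGS_hard hK hτ v)
  have hw := isProbabilityMeasure_of_memGS (memGS_hard hK hτ w)
  have := hv.2
  have := hw.1
  have := hw.2
  have h1 : ∀ x, hardEta K v x ≤ ((3:NNReal):ℝ) * hardEta K w x := fun x => by
    rw [NNReal.coe_ofNat]
    linarith [(hardEta_mem hK v x).2, (hardEta_mem hK w x).1]
  have h2 : ∀ x, 1 - hardEta K v x ≤ ((3:NNReal):ℝ) * (1 - hardEta K w x) := fun x => by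
    rw [NNReal.coe_ofNat]
    linarith [(hardEta_mem hK v x).1, (hardEta_mem hK w x).2]
  exact sampleMeasure_le_smul (covMeasure_le_smul (hardPa_nonneg hτ) h1 h2)
    (covMeasure_le_smul (hardPb_nonneg hτ) h1 h2)

lemma card_filter_eq_true_eq_false {ι : Type*} [Fintype ι] [DecidableEq ι] (j : ι) :
    (Finset.univ.filter fun v : ι → Bool => v j = true).card
      = (Finset.univ.filter fun v : ι → Bool => v j = false).card := by
  refine Finset.card_nbij' (fun v => Function.update v j false)
    (fun v => Function.update v j true) ?_ ?_ ?_ ?_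
  · intro v _; simp
  · intro v _; simp
  · intro v hv
    have : v j = true := by simpa using hv
    simp [← this]
  · intro v hv
    have : v j = false := by simpa using hv
    simp [← this]

lemma integral_condGS {K : ℕ} (nmaj nmin : ℕ) {τ : ℝ} (j : Fin K) (b : Bool)
    {g : Sample nmaj nmin → ℝ}
    (hg : ∀ v, Integrable g (hardGSMeasure K nmaj nmin τ v)) :
    ((Finset.univ.filter fun v : Fin K → Bool => v j = b).card : ℝ)
        * ∫ S, g S ∂condGS K nmaj nmin τ j b
      = ∑ v ∈ Finset.univ.filter (fun v : Fin K → Bool => v j = b),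
          ∫ S, g S ∂hardGSMeasure K nmaj nmin τ v := by
  have hne : ((Finset.univ.filter fun v : Fin K → Bool => v j = b).card : ℝ) ≠ 0 := by
    rw [Nat.cast_ne_zero, Finset.card_ne_zero]
    exact ⟨fun _ => b, by simp⟩
  rw [condGS, integral_smul_measure, integral_finsetSum_measure fun v _ => hg v,
    ENNReal.toReal_inv, ENNReal.toReal_natCast, smul_eq_mul, mul_inv_cancel_left₀ hne]

lemma condGS_isProbabilityMeasure {K : ℕ} (hK : 0 < K) (nmaj nmin : ℕ) {τ : ℝ}
    (hτ : τ ∈ Icc (0:ℝ) 1) (j : Fin K) (b : Bool) :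
    IsProbabilityMeasure (condGS K nmaj nmin τ j b) := by
  refine ⟨?_⟩
  have hne : ((Finset.univ.filter fun v : Fin K → Bool => v j = b).card : ℝ≥0∞) ≠ 0 := by
    rw [Nat.cast_ne_zero, Finset.card_ne_zero]
    exact ⟨fun _ => b, by simp⟩
  have h1 : ∀ v, hardGSMeasure K nmaj nmin τ v univ = 1 := fun v =>
    (hardGS_isProbabilityMeasure hK nmaj nmin hτ v).measure_univ
  simp only [condGS, Measure.smul_apply, Measure.finsetSum_apply, h1, Finset.sum_const,
    nsmul_eq_mul, mul_one, smul_eq_mul]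
  exact ENNReal.inv_mul_cancel hne (ENNReal.natCast_ne_top _)

lemma condGS_le_smul {K : ℕ} (hK : 0 < K) (nmaj nmin : ℕ) {τ : ℝ} (hτ : τ ∈ Icc (0:ℝ) 1)
    (j : Fin K) (b c : Bool) :
    condGS K nmaj nmin τ j b ≤ (3:NNReal) ^ (nmaj + nmin) • condGS K nmaj nmin τ j c := by
  have hne : ∀ b, ((Finset.univ.filter fun v : Fin K → Bool => v j = b).card : ℝ≥0∞) ≠ 0 :=
    fun b => by
      rw [Nat.cast_ne_zero, Finset.card_ne_zero]
      exact ⟨fun _ => b, by simp⟩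
  let D : ℝ≥0∞ := ENNReal.ofNNReal ((3:NNReal) ^ (nmaj + nmin))
  have h1 : ∀ w, condGS K nmaj nmin τ j b ≤ D • hardGSMeasure K nmaj nmin τ w := fun w => by
    refine Measure.le_iff.2 fun s _ => ?_
    simp only [condGS, Measure.smul_apply, Measure.finsetSum_apply, smul_eq_mul]
    calc _ ≤ ((Finset.univ.filter fun v : Fin K → Bool => v j = b).card : ℝ≥0∞)⁻¹ *
          ∑ v ∈ Finset.univ.filter (fun v : Fin K → Bool => v j = b),
            D * hardGSMeasure K nmaj nmin τ w s := by
          gcongr with v _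
          exact hardGSMeasure_le_smul hK nmaj nmin hτ v w s
      _ = D * hardGSMeasure K nmaj nmin τ w s := by
          rw [Finset.sum_const, nsmul_eq_mul, ← mul_assoc,
            ENNReal.inv_mul_cancel (hne b) (ENNReal.natCast_ne_top _), one_mul]
  refine Measure.le_iff.2 fun s _ => ?_
  change _ ≤ D * condGS K nmaj nmin τ j c s
  have hc : condGS K nmaj nmin τ j c s
      = ((Finset.univ.filter fun v : Fin K → Bool => v j = c).card : ℝ≥0∞)⁻¹ *
        ∑ v ∈ Finset.univ.filter (fun v : Fin K → Bool => v j = c),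
          hardGSMeasure K nmaj nmin τ v s := by
    simp only [condGS, Measure.smul_apply, Measure.finsetSum_apply, smul_eq_mul]
  rw [hc, mul_left_comm, Finset.mul_sum, ← one_mul (condGS K nmaj nmin τ j b s),
    ← ENNReal.inv_mul_cancel (hne c) (ENNReal.natCast_ne_top _), mul_assoc, ← nsmul_eq_mul]
  gcongr
  exact Finset.card_nsmul_le_sum _ _ _ fun w _ => h1 w s

/-- The two-point testing lower bound in a single bin. -/
lemma exp_neg_klDiv'_le_binLoss {nmaj nmin K : ℕ} (hK : 0 < K) {τ : ℝ} (hτ : τ ∈ Icc (0:ℝ) 1)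
    {A : Sample nmaj nmin → ℝ → Bool} (hA : MeasurableAlg nmaj nmin A) (j : Fin K) :
    (1/(16*(K:ℝ)^2)) *
        Real.exp (-(klDiv' (condGS K nmaj nmin τ j true) (condGS K nmaj nmin τ j false)))
      ≤ (∫ S, binLoss K (A S) j true ∂condGS K nmaj nmin τ j true)
        + ∫ S, binLoss K (A S) j false ∂condGS K nmaj nmin τ j false := by
  have := condGS_isProbabilityMeasure hK nmaj nmin hτ j true
  have := condGS_isProbabilityMeasure hK nmaj nmin hτ j false
  have hK' : (0:ℝ) < K := by exact_mod_cast hK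
  have hc : 0 < 8*(K:ℝ)^2 := by positivity
  have hcomp : ∀ S, 1 - 8*(K:ℝ)^2 * binLoss K (A S) j true
      = 8*(K:ℝ)^2 * binLoss K (A S) j false := fun S => by
    have h := binLoss_true_add_false (hA.measurable_apply S) j
    rw [eq_div_iff hc.ne'] at h
    linarith
  have h := half_exp_neg_klDiv'_le (pow_ne_zero _ three_ne_zero)
    (condGS_le_smul hK nmaj nmin hτ j true false)
    (T := fun S => 8*(K:ℝ)^2 * binLoss K (A S) j true)
    ((measurable_binLoss hA j true).const_mul _)
    (fun S => mul_nonneg hc.le (binLoss_nonneg _ j true))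
    (fun S => by linarith [hcomp S, mul_nonneg hc.le (binLoss_nonneg (A S) j false)])
  simp only [hcomp, integral_const_mul] at h
  rw [← mul_add] at h
  calc _ = (1/2 * Real.exp
          (-(klDiv' (condGS K nmaj nmin τ j true) (condGS K nmaj nmin τ j false))))
          / (8*(K:ℝ)^2) := by ring
    _ ≤ _ := (div_le_iff₀' hc).2 h

/-- **Lemma (group-shift lower-bound decomposition).** For any positive integers
`K, n_maj, n_min` and any `τ ∈ [0,1]`, the minimax excess risk over `𝒫_GS(τ)` is at least
`(1/(32K²)) Σ_{j=1}^K exp(-KL(Q(S | v_j = 1) ‖ Q(S | v_j = -1)))`, for the hard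
group-shift family. -/
theorem group_shift_lower_bound_decomposition
    (K nmaj nmin : ℕ) (hK : 0 < K) (hmin : 1 ≤ nmin) (hmaj : nmin < nmaj)
    (τ : ℝ) (hτ : τ ∈ Icc (0:ℝ) 1)
    (A : Sample nmaj nmin → ℝ → Bool) (hA : MeasurableAlg nmaj nmin A) :
    (1/(32*(K:ℝ)^2)) * ∑ j : Fin K,
        Real.exp (-(klDiv' (condGS K nmaj nmin τ j true) (condGS K nmaj nmin τ j false)))
      ≤ ⨆ P : {P : Measure (ℝ × Bool) × Measure (ℝ × Bool) // memGS τ P.1 P.2},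
          excessRisk nmaj nmin A P.1.1 P.1.2 := by
  set M := ⨆ P : {P : Measure (ℝ × Bool) × Measure (ℝ × Bool) // memGS τ P.1 P.2},
    excessRisk nmaj nmin A P.1.1 P.1.2
  have hbdd : BddAbove (range fun P : {P : Measure (ℝ × Bool) × Measure (ℝ × Bool) //
      memGS τ P.1 P.2} => excessRisk nmaj nmin A P.1.1 P.1.2) := by
    refine ⟨1, ?_⟩
    rintro _ ⟨P, rfl⟩
    have := (isProbabilityMeasure_of_memGS P.2).1
    have := (isProbabilityMeasure_of_memGS P.2).2
    exact excessRisk_le_one A _ _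
  have hv : ∀ v : Fin K → Bool,
      ∑ j, ∫ S, binLoss K (A S) j (v j) ∂hardGSMeasure K nmaj nmin τ v ≤ M := fun v =>
    (sum_integral_binLoss_le_excessRisk hK hτ hA v).trans
      (le_ciSup hbdd ⟨(_, _), memGS_hard hK hτ v⟩)
  have hfin : ∀ v, IsProbabilityMeasure (hardGSMeasure K nmaj nmin τ v) :=
    hardGS_isProbabilityMeasure hK nmaj nmin hτ
  set N : ℝ := ((Fintype.card (Fin K → Bool) : ℕ) : ℝ) with hN
  have hNpos : 0 < N := by rw [hN]; exact_mod_cast Fintype.card_pos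
  have htot : ∑ v : Fin K → Bool,
      ∑ j, ∫ S, binLoss K (A S) j (v j) ∂hardGSMeasure K nmaj nmin τ v ≤ N * M := by
    refine (Finset.sum_le_card_nsmul _ _ M fun v _ => hv v).trans_eq ?_
    rw [nsmul_eq_mul, Finset.card_univ]
  have hj : ∀ j : Fin K, N / 2 * ((1/(16*(K:ℝ)^2)) *
        Real.exp (-(klDiv' (condGS K nmaj nmin τ j true) (condGS K nmaj nmin τ j false))))
      ≤ ∑ v : Fin K → Bool, ∫ S, binLoss K (A S) j (v j) ∂hardGSMeasure K nmaj nmin τ v := by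
    intro j
    have hsplit := Finset.sum_filter_add_sum_filter_not Finset.univ
      (fun v : Fin K → Bool => v j = true)
      (fun v => ∫ S, binLoss K (A S) j (v j) ∂hardGSMeasure K nmaj nmin τ v)
    have hcard := Finset.card_filter_add_card_filter_not (s := Finset.univ)
      (fun v : Fin K → Bool => v j = true)
    simp only [Bool.not_eq_true] at hsplit hcard
    have hsub : ∀ b, ∑ v ∈ Finset.univ.filter (fun v : Fin K → Bool => v j = b),
          ∫ S, binLoss K (A S) j (v j) ∂hardGSMeasure K nmaj nmin τ v
        = ((Finset.univ.filter fun v : Fin K → Bool => v j = b).card : ℝ)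
          * ∫ S, binLoss K (A S) j b ∂condGS K nmaj nmin τ j b := fun b => by
      rw [integral_condGS nmaj nmin j b fun v => integrable_binLoss_sample hA j b _]
      refine Finset.sum_congr rfl fun v hv => ?_
      rw [(Finset.mem_filter.1 hv).2]
    have h1 : ((Finset.univ.filter fun v : Fin K → Bool => v j = false).card : ℝ) = N / 2 := by
      rw [card_filter_eq_true_eq_false, Finset.card_univ] at hcard
      rw [hN, ← hcard]
      push_cast
      ring
    rw [← hsplit, hsub, hsub, card_filter_eq_true_eq_false, h1, ← mul_add]
    exact mul_le_mul_of_nonneg_left (exp_neg_klDiv'_le_binLoss hK hτ hA j) (by positivity)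
  rw [Finset.sum_comm] at htot
  have hsum := (Finset.sum_le_sum fun j _ => hj j).trans htot
  rw [← Finset.mul_sum, ← Finset.mul_sum] at hsum
  refine le_of_mul_le_mul_left (le_trans (le_of_eq ?_) hsum) hNpos
  ring
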